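/- arXiv:1506.06424 — 2 statements merged into one kernel-verified Lean document; each statement's English description precedes it below -/
import Mathlib

section
/- Let f : X → Y be a dominant morphism of varieties over an algebraically closed field and let v be a divisorial valuation of the function field k(X) with center on X. Then the restriction of v to k(Y) is a positive integer multiple of a divisorial valuation of k(Y) with center on Y. More precisely, if k_v denotes the residue field of the valuation ring of v and w = v|_{k(Y)} with residue field k_w, then trdeg(k_w/k) = dim(Y) − 1. -/
/-- The transcendence degree of a `k`-algebra `K`: the supremum of the cardinalities
of algebraically independent subsets. -/
noncomputable def trdeg (k K : Type*) [CommRing k] [CommRing K] [Algebra k K] :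
    Cardinal :=
  ⨆ s : {s : Set K // AlgebraicIndependent k ((↑) : s → K)}, Cardinal.mk s.1

/-- The `k`-algebra structure on the residue field of a valuation subring `A ⊆ K`
containing (the image of) `k`. -/
noncomputable def residueFieldAlgebra {k K : Type*} [Field k] [Field K] [Algebra k K]
    (A : ValuationSubring K) (h : ∀ c : k, algebraMap k K c ∈ A) :
    Algebra k (IsLocalRing.ResidueField A) :=
  ((IsLocalRing.residue A).comp ((algebraMap k K).codRestrict A.toSubring h)).toAlgebra

universe u

theorem aux_low {L K R κB κA : Type*} [Field L] [Field K] [Algebra L K] [CommRing R]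
    [Field κB] [Field κA] [Algebra κB κA] (B : ValuationSubring L)
    (j : R →+* K) (hj : Function.Injective j) (φ : B →+* R) (rB : B →+* κB) (rA : R →+* κA)
    (h1 : ∀ b, algebraMap κB κA (rB b) = rA (φ b))
    (h2 : ∀ b : B, j (φ b) = algebraMap L K b)
    {ι : Type*} (x : ι → R) (hx : AlgebraicIndependent κB (fun i => rA (x i))) :
    AlgebraicIndependent L (fun i => j (x i)) := by
  rw [algebraicIndependent_iff]
  intro p hp
  by_contra hp0
  have hne : p.support.Nonempty := by
    rwa [MvPolynomial.support_nonempty]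
  obtain ⟨m, hm, hmax⟩ := p.support.exists_max_image (fun i => B.valuation (p.coeff i)) hne
  have hm0 : p.coeff m ≠ 0 := MvPolynomial.mem_support_iff.mp hm
  have hmem : ∀ i, (p.coeff m)⁻¹ * p.coeff i ∈ B := by
    intro i
    by_cases hi : i ∈ p.support
    · rw [← B.valuation_le_one_iff, map_mul, map_inv₀]
      have hv : B.valuation (p.coeff m) ≠ 0 := by simpa using hm0
      calc _ ≤ (B.valuation (p.coeff m))⁻¹ * B.valuation (p.coeff m) := by
            gcongr
            exact hmax i hi
        _ = 1 := inv_mul_cancel₀ hv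
    · rw [MvPolynomial.notMem_support_iff.mp hi, mul_zero]
      exact B.zero_mem
  obtain ⟨q, hq⟩ : ∃ q : MvPolynomial ι B,
      MvPolynomial.map B.subtype q = MvPolynomial.C (p.coeff m)⁻¹ * p := by
    have : MvPolynomial.C (p.coeff m)⁻¹ * p ∈ Set.range (MvPolynomial.map (σ := ι) B.subtype) := by
      rw [MvPolynomial.mem_range_map_iff_coeffs_subset]
      intro c hc
      obtain ⟨n, -, rfl⟩ := MvPolynomial.mem_coeffs_iff.mp hc
      rw [MvPolynomial.coeff_C_mul]
      exact ⟨⟨_, hmem n⟩, rfl⟩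
    exact this
  have e1 : MvPolynomial.eval₂ φ x q = 0 := by
    apply hj
    rw [map_zero, MvPolynomial.hom_eval₂]
    have : j.comp φ = (algebraMap L K).comp B.subtype := RingHom.ext h2
    rw [this, ← MvPolynomial.eval₂_map, hq, MvPolynomial.eval₂_mul]
    have : MvPolynomial.eval₂ (algebraMap L K) (fun i => j (x i)) p = 0 := hp
    rw [this, mul_zero]
  have e2 : MvPolynomial.map rB q = 0 := by
    apply (algebraicIndependent_iff.mp hx)
    have := congrArg rA e1
    rw [map_zero, MvPolynomial.hom_eval₂] at this
    have h3 : rA.comp φ = (algebraMap κB κA).comp rB := RingHom.ext fun b => (h1 b).symm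
    rw [h3, ← MvPolynomial.eval₂_map] at this
    exact this
  have e3 : q.coeff m = 1 := by
    have := congrArg (MvPolynomial.coeff m) hq
    rw [MvPolynomial.coeff_map, MvPolynomial.coeff_C_mul, inv_mul_cancel₀ hm0] at this
    exact Subtype.ext this
  have := congrArg (MvPolynomial.coeff m) e2
  rw [MvPolynomial.coeff_map, e3] at this
  simp at this

theorem aux_up {k : Type*} {R κ : Type*} [Field k] [CommRing R] [IsDomain R] [Field κ]
    [Algebra k R] [Algebra k κ] (f : R →ₐ[k] κ) (t : R) (ht : t ≠ 0) (hft : f t = 0)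
    {ι : Type*} (x : ι → R) (hx : AlgebraicIndependent k (f ∘ x)) :
    AlgebraicIndependent k (fun o : Option ι => o.elim t x) := by
  have hx' := AlgebraicIndependent.of_comp f hx
  rw [hx'.option_iff_transcendental]
  intro halg
  obtain ⟨q, hq0, hq⟩ := halg.exists_nonzero_coeff_and_aeval_eq_zero
    (mem_nonZeroDivisors_of_ne_zero ht)
  have key := map_dvd (Polynomial.aeval t) (Polynomial.X_dvd_sub_C (p := q))
  rw [map_sub, hq, zero_sub, dvd_neg, Polynomial.aeval_X, Polynomial.aeval_C] at key
  have h0 : f (q.coeff 0 : R) = 0 := by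
    obtain ⟨c, hc⟩ := key
    have hc' : (q.coeff 0 : R) = t * c := hc
    rw [hc', map_mul, hft, zero_mul]
  have hmem : ((q.coeff 0 : Algebra.adjoin k (Set.range x)) : R) ∈
      (MvPolynomial.aeval x : MvPolynomial ι k →ₐ[k] R).range :=
    Algebra.adjoin_range_eq_range_aeval k x ▸ (q.coeff 0).2
  obtain ⟨p, hp⟩ := hmem
  have hp' : MvPolynomial.aeval x p = (q.coeff 0 : R) := hp
  have : MvPolynomial.aeval (f ∘ x) p = 0 := by
    rw [← h0, ← hp']
    have : MvPolynomial.aeval (f ∘ x) = f.comp (MvPolynomial.aeval x) := by ext; simp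
    rw [this]; rfl
  have hp0 := algebraicIndependent_iff.mp hx p this
  rw [hp0, map_zero] at hp'
  exact hq0 (Subtype.ext hp'.symm)

theorem aux_up_trdeg {k : Type*} {R κ : Type u} [Field k] [CommRing R] [IsDomain R] [Field κ]
    [Algebra k R] [Algebra k κ] (f : R →ₐ[k] κ) (hf : Function.Surjective f)
    (t : R) (ht : t ≠ 0) (hft : f t = 0) :
    Algebra.trdeg k κ + 1 ≤ Algebra.trdeg k R := by
  obtain ⟨s, hs⟩ := exists_isTranscendenceBasis k κ
  rw [← hs.cardinalMk_eq_trdeg, ← Cardinal.mk_option]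
  choose g hg using hf
  refine (aux_up f t ht hft (fun i : s => g i) ?_).cardinalMk_le_trdeg
  have : (f ∘ fun i : s => g i) = Subtype.val := funext fun i => hg i
  rw [this]
  exact hs.1

theorem aux_low_trdeg {L κB : Type*} {K R κA : Type u} [Field L] [Field K] [Algebra L K]
    [CommRing R]
    [Field κB] [Field κA] [Algebra κB κA] (B : ValuationSubring L)
    (j : R →+* K) (hj : Function.Injective j) (φ : B →+* R) (rB : B →+* κB) (rA : R →+* κA)
    (hrA : Function.Surjective rA)
    (h1 : ∀ b, algebraMap κB κA (rB b) = rA (φ b))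
    (h2 : ∀ b : B, j (φ b) = algebraMap L K b) :
    Algebra.trdeg κB κA ≤ Algebra.trdeg L K := by
  obtain ⟨s, hs⟩ := exists_isTranscendenceBasis κB κA
  rw [← hs.cardinalMk_eq_trdeg]
  choose g hg using hrA
  refine (aux_low B j hj φ rB rA h1 h2 (fun i : s => g i) ?_).cardinalMk_le_trdeg
  simp only [hg]
  exact hs.1

theorem trdeg_eq_alg (k K : Type*) [CommRing k] [CommRing K] [Algebra k K] :
    trdeg k K = Algebra.trdeg k K := rfl

/-- Restriction of a divisorial valuation along a dominant morphism.  Algebraic form: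
let `k` be an algebraically closed field, `L ⊆ K` finitely generated field extensions of
`k` (the function fields `k(Y) ⊆ k(X)` of varieties with `f : X → Y` dominant, so
`dim X = trdeg K = dX` and `dim Y = trdeg L = dY`), and let `A` be the valuation subring
of a divisorial valuation `v` of `K` over `k` (so its residue field `k_v` satisfies
`trdeg(k_v/k) = dim X − 1`).  If the restriction `w = v|_L` is nontrivial (as is the case
when `v` has center on `X`), then its residue field `k_w` satisfies
`trdeg(k_w/k) = dim Y − 1`; hence `w` is a positive integer multiple of a divisorial
valuation of `L` with center on `Y`. -/
theorem stmt_4 (k L K : Type*) [Field k] [IsAlgClosed k] [Field L] [Field K]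
    [Algebra k L] [Algebra k K] [Algebra L K] [IsScalarTower k L K]
    (dX dY : ℕ) (hdX1 : 1 ≤ dX) (hdY1 : 1 ≤ dY)
    (hKfg : ∃ s : Finset K, IntermediateField.adjoin k (s : Set K) = ⊤)
    (hLfg : ∃ s : Finset L, IntermediateField.adjoin k (s : Set L) = ⊤)
    (hdX : trdeg k K = dX) (hdY : trdeg k L = dY)
    (A : ValuationSubring K)
    (hkA : ∀ c : k, algebraMap k K c ∈ A)
    (hdiv : @trdeg k (IsLocalRing.ResidueField A) _ _ (residueFieldAlgebra A hkA) =
      ((dX - 1 : ℕ) : Cardinal))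
    (hnontriv : A.comap (algebraMap L K) ≠ ⊤) :
    @trdeg k (IsLocalRing.ResidueField (A.comap (algebraMap L K))) _ _
      (residueFieldAlgebra (A.comap (algebraMap L K))
        (fun c => by
          show algebraMap L K (algebraMap k L c) ∈ A
          rw [← IsScalarTower.algebraMap_apply]
          exact hkA c)) = ((dY - 1 : ℕ) : Cardinal) := by
  rw [trdeg_eq_alg] at hdX hdY hdiv ⊢
  set B := A.comap (algebraMap L K) with hB
  have hkB : ∀ c : k, algebraMap k L c ∈ B := fun c => by
    show algebraMap L K (algebraMap k L c) ∈ A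
    rw [← IsScalarTower.algebraMap_apply]
    exact hkA c
  let φ : B →+* A := ((algebraMap L K).comp B.subtype).codRestrict A.toSubring (fun b => b.2)
  have hφ : ∀ b : B, ((φ b : A) : K) = algebraMap L K b := fun b => rfl
  haveI : IsLocalHom φ := by
    constructor
    intro b hb
    rw [A.valuation_eq_one_iff] at hb
    have hb0 : (b : L) ≠ 0 := by
      intro h
      rw [hφ, h] at hb
      simp at hb
    have hinv : (b : L)⁻¹ ∈ B := by
      show algebraMap L K (b : L)⁻¹ ∈ A
      rw [← A.valuation_le_one_iff, map_inv₀, map_inv₀, ← hφ, hb, inv_one]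
    exact IsUnit.of_mul_eq_one (⟨_, hinv⟩ : B) (Subtype.ext (mul_inv_cancel₀ hb0))
  -- upper bound
  letI i1 : Algebra k (IsLocalRing.ResidueField B) := residueFieldAlgebra B hkB
  letI i2 : Algebra k (IsLocalRing.ResidueField A) := residueFieldAlgebra A hkA
  letI i3 : Algebra (IsLocalRing.ResidueField B) (IsLocalRing.ResidueField A) :=
    (IsLocalRing.ResidueField.map φ).toAlgebra
  haveI i4 : IsScalarTower k (IsLocalRing.ResidueField B) (IsLocalRing.ResidueField A) := by
    refine IsScalarTower.of_algebraMap_eq fun c => ?_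
    change IsLocalRing.residue A ⟨algebraMap k K c, hkA c⟩ =
      IsLocalRing.residue A (φ ⟨algebraMap k L c, hkB c⟩)
    congr 1
    exact Subtype.ext (IsScalarTower.algebraMap_apply k L K c)
  letI i5 : Algebra k B := ((algebraMap k L).codRestrict B.toSubring hkB).toAlgebra
  have hup : Algebra.trdeg k (IsLocalRing.ResidueField B) + 1 ≤ Algebra.trdeg k L := by
    obtain ⟨y, hy⟩ : ∃ y : L, y ∉ B := by
      by_contra! h
      exact hnontriv (by ext z; simp [h z])
    have hy0 : y ≠ 0 := fun h => hy (h ▸ B.zero_mem)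
    have hyi : y⁻¹ ∈ B := (B.mem_or_inv_mem y).resolve_left hy
    let f : B →ₐ[k] IsLocalRing.ResidueField B :=
      { IsLocalRing.residue B with commutes' := fun c => rfl }
    let g : B →ₐ[k] L := { B.subtype with commutes' := fun c => rfl }
    refine (aux_up_trdeg f IsLocalRing.residue_surjective ⟨y⁻¹, hyi⟩ ?_ ?_).trans
      (_root_.trdeg_le_of_injective g Subtype.val_injective)
    · intro h
      exact inv_ne_zero hy0 (congrArg Subtype.val h)
    · change IsLocalRing.residue B _ = 0
      rw [IsLocalRing.residue_eq_zero_iff, IsLocalRing.mem_maximalIdeal, mem_nonunits_iff,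
        B.valuation_eq_one_iff]
      intro h
      apply hy
      rw [← B.valuation_le_one_iff]
      rw [map_inv₀, inv_eq_one] at h
      exact h.le
  have hlow : Algebra.trdeg (IsLocalRing.ResidueField B) (IsLocalRing.ResidueField A) ≤
      Algebra.trdeg L K :=
    aux_low_trdeg B A.subtype Subtype.val_injective φ (IsLocalRing.residue B)
      (IsLocalRing.residue A) IsLocalRing.residue_surjective (fun b => rfl) hφ
  have s1 := lift_trdeg_add_eq k L K
  have s2 := lift_trdeg_add_eq k (IsLocalRing.ResidueField B)
    (IsLocalRing.ResidueField A)
  have hdiv' : Algebra.trdeg k (IsLocalRing.ResidueField A) = ((dX - 1 : ℕ) : Cardinal) := hdiv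
  change Algebra.trdeg k (IsLocalRing.ResidueField B) = _
  rw [hdX, hdY] at s1
  rw [hdiv'] at s2
  rw [hdY] at hup
  generalize Algebra.trdeg k (IsLocalRing.ResidueField B) = a at *
  generalize Algebra.trdeg (IsLocalRing.ResidueField B) (IsLocalRing.ResidueField A) = c at *
  generalize Algebra.trdeg L K = e at *
  have ha : a < Cardinal.aleph0 :=
    (self_le_add_right a 1).trans_lt (hup.trans_lt (Cardinal.natCast_lt_aleph0))
  obtain ⟨a, rfl⟩ := Cardinal.lt_aleph0.mp ha
  have he : e < Cardinal.aleph0 := by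
    rw [← Cardinal.lift_lt_aleph0]
    refine (self_le_add_left _ _).trans_lt (s1.trans_lt ?_)
    simp
  obtain ⟨e, rfl⟩ := Cardinal.lt_aleph0.mp he
  obtain ⟨c, rfl⟩ := Cardinal.lt_aleph0.mp (hlow.trans_lt he)
  simp only [Cardinal.lift_natCast] at s1 s2
  norm_cast at s1 s2 hup hlow ⊢
  omega
end

section
/- Let f : V → W be a morphism of algebraic varieties over a field k, let d ≥ 0, and let A ⊆ V be a constructible subset such that dim(f^{-1}(y) ∩ A) ≤ d for every y ∈ f(A). Then for every subset B ⊆ A, dim(B̄) ≤ d + dim(closure of f(B)). -/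
open AlgebraicGeometry CategoryTheory

/-- A constructible subset of a topological space: a finite union of locally closed
sets. -/
def IsConstructibleSet {X : Type*} [TopologicalSpace X] (A : Set X) : Prop :=
  ∃ (m : ℕ) (U Z : Fin m → Set X),
    (∀ i, IsOpen (U i)) ∧ (∀ i, IsClosed (Z i)) ∧ A = ⋃ i, U i ∩ Z i


theorem aux_integral_dim (R S : Type*) [CommRing R] [CommRing S] [IsDomain S] [Algebra R S]
    [Algebra.IsIntegral R S] (hinj : Function.Injective (algebraMap R S)) :
    ringKrullDim S = ringKrullDim R := by
  apply le_antisymm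
  · exact Order.krullDim_le_of_strictMono (PrimeSpectrum.comap (algebraMap R S))
      (fun P Q h => Ideal.IsIntegral.comap_lt_comap (I := P.asIdeal) (J := Q.asIdeal) h)
  · refine iSup_le fun l => ?_
    obtain ⟨Q, hQ, hQp⟩ := (Ideal.exists_ideal_over_prime_of_isIntegral_of_isDomain
      (S := S) l.head.asIdeal (by rw [(RingHom.injective_iff_ker_eq_bot _).mp hinj]; exact bot_le))
    have : Q.LiesOver l.head.asIdeal := ⟨hQp.symm⟩
    obtain ⟨M, hM⟩ := Ideal.exists_ltSeries_of_hasGoingUp l Q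
    rw [← hM.1]
    exact Order.LTSeries.length_le_krullDim M

theorem aux_dim_trdeg (K D : Type*) [Field K] [CommRing D] [IsDomain D] [Algebra K D]
    [Algebra.FiniteType K D] :
    ∃ n : ℕ, Algebra.trdeg K D = n ∧ ringKrullDim D = n := by
  obtain ⟨s, g, hg, hi⟩ := exists_integral_inj_algHom_of_fg K D
  let _ := g.toRingHom.toAlgebra
  have : IsScalarTower K (MvPolynomial (Fin s) K) D :=
    IsScalarTower.of_algebraMap_eq' g.comp_algebraMap.symm
  have : Algebra.IsIntegral (MvPolynomial (Fin s) K) D := ⟨hi⟩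
  have : FaithfulSMul (MvPolynomial (Fin s) K) D :=
    (faithfulSMul_iff_algebraMap_injective _ _).mpr hg
  refine ⟨s, ?_, ?_⟩
  · have h := lift_trdeg_add_eq K (MvPolynomial (Fin s) K) D
    rw [MvPolynomial.trdeg_of_isDomain, trdeg_eq_zero] at h
    simpa using h.symm
  · rw [aux_integral_dim (MvPolynomial (Fin s) K) D hg]
    simp

theorem aux_dim_field (K S L : Type*) [Field K] [CommRing S] [Algebra K S]
    [Algebra.FiniteType K S] [Field L] [Algebra K L] [Algebra S L] [IsScalarTower K S L]
    (h : ∀ x : L, ∃ a b : S, algebraMap S L b ≠ 0 ∧ x * algebraMap S L b = algebraMap S L a) :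
    ∃ n : ℕ, Algebra.trdeg K L = n ∧
      ringKrullDim (S ⧸ RingHom.ker (algebraMap S L)) = n := by
  let D := (IsScalarTower.toAlgHom K S L).range
  have : Algebra.FiniteType K D := .of_surjective (IsScalarTower.toAlgHom K S L).rangeRestrict
    (AlgHom.rangeRestrict_surjective _)
  obtain ⟨n, h1, h2⟩ := aux_dim_trdeg K D
  refine ⟨n, ?_, ?_⟩
  · have : Algebra.IsAlgebraic D L := by
      refine ⟨fun x => ?_⟩
      obtain ⟨a, b, hb, hab⟩ := h x
      let a' : D := ⟨algebraMap S L a, a, rfl⟩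
      let b' : D := ⟨algebraMap S L b, b, rfl⟩
      refine ⟨Polynomial.C b' * Polynomial.X - Polynomial.C a', ?_, ?_⟩
      · intro h0
        have := congrArg (fun p => Polynomial.coeff p 1) h0
        simp at this
        exact hb (congrArg Subtype.val this)
      · simp only [map_sub, map_mul, Polynomial.aeval_C, Polynomial.aeval_X]
        change algebraMap S L b * x - algebraMap S L a = 0
        rw [← hab]; ring
    have h := trdeg_add_eq K D (A := L)
    rw [trdeg_eq_zero (R := D)] at h
    rw [← h, h1]; simp
  · rw [← h2]
    exact ringKrullDim_eq_of_ringEquiv (RingHom.quotientKerEquivRange (algebraMap S L))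
open TopologicalSpace Topology in
theorem aux_dim_local {X : Type*} [TopologicalSpace X] (n : WithBot ℕ∞)
    (h : ∀ x : X, ∃ U : Set X, IsOpen U ∧ x ∈ U ∧ topologicalKrullDim U ≤ n) :
    topologicalKrullDim X ≤ n := by
  refine iSup_le fun l => ?_
  obtain ⟨x, hx⟩ := l.head.isIrreducible.nonempty
  obtain ⟨U, hU, hxU, hd⟩ := h x
  refine le_trans ?_ hd
  let e := IrreducibleCloseds.orderIsoOfIsOpenEmbedding (Subtype.val : U → X)
    hU.isOpenEmbedding_subtypeVal
  have hm : ∀ i, ((Subtype.val : U → X) ⁻¹' (l i : Set X)).Nonempty := fun i =>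
    ⟨⟨x, hxU⟩, (LTSeries.head_le l i : l.head ≤ l i) hx⟩
  exact Order.LTSeries.length_le_krullDim (LTSeries.mk l.length (fun i => e.symm ⟨l i, hm i⟩)
    (fun i j hij => e.symm.strictMono (Subtype.mk_lt_mk.mpr (l.strictMono hij))))

open TopologicalSpace Topology in
theorem aux_irred_preimage {X Y : Type*} [TopologicalSpace X] [TopologicalSpace Y]
    (g : Y → X) (hg : IsInducing g) (S : Set X) (hS : IsIrreducible S) (hr : S ⊆ Set.range g) :
    IsIrreducible (g ⁻¹' S) := by
  constructor
  · obtain ⟨s, hs⟩ := hS.nonempty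
    obtain ⟨y, rfl⟩ := hr hs
    exact ⟨y, hs⟩
  · rintro u v hu hv ⟨a, ha, hau⟩ ⟨b, hb, hbv⟩
    obtain ⟨u', hu', rfl⟩ := hg.isOpen_iff.mp hu
    obtain ⟨v', hv', rfl⟩ := hg.isOpen_iff.mp hv
    obtain ⟨c, hc, hcu, hcv⟩ := hS.isPreirreducible u' v' hu' hv' ⟨_, ha, hau⟩ ⟨_, hb, hbv⟩
    obtain ⟨y, rfl⟩ := hr hc
    exact ⟨y, hc, hcu, hcv⟩

open TopologicalSpace Topology in
theorem aux_dim_closure {X : Type*} [TopologicalSpace X] [NoetherianSpace X] [QuasiSober X]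
    (B : Set X) (n : WithBot ℕ∞)
    (h : ∀ z : X, z ∈ closure (B ∩ closure {z}) → topologicalKrullDim ↥(closure {z}) ≤ n) :
    topologicalKrullDim ↥(closure B) ≤ n := by
  refine iSup_le fun l => ?_
  obtain ⟨Z, hZ, hlZ⟩ := exists_mem_irreducibleComponents_subset_of_isIrreducible _
    l.last.isIrreducible
  obtain ⟨o, ho, ⟨w, hw⟩, hoZ⟩ :=
    NoetherianSpace.exists_isOpen_nonempty_subset_irreducibleComponent Z hZ
  have hirr : IsIrreducible ((Subtype.val : closure B → X) '' Z) :=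
    hZ.1.image _ continuous_subtype_val.continuousOn
  have hcl : IsClosed ((Subtype.val : closure B → X) '' Z) :=
    isClosed_closure.isClosedEmbedding_subtypeVal.isClosedMap _
      (isClosed_of_mem_irreducibleComponents Z hZ)
  have hz := hirr.closure_genericPoint hcl
  set z := hirr.genericPoint
  obtain ⟨O, hO, rfl⟩ := isOpen_induced_iff.mp ho
  have hzO : z ∈ O := by
    have : z ⤳ w.1 := specializes_iff_mem_closure.mpr (hz ▸ ⟨w, hoZ hw, rfl⟩)
    exact this.mem_open hO hw
  have hzB : z ∈ closure B := by
    have : z ∈ (Subtype.val : closure B → X) '' Z := hz ▸ subset_closure rfl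
    obtain ⟨a, _, ha⟩ := this
    exact ha ▸ a.2
  have key : z ∈ closure (B ∩ closure {z}) := by
    refine mem_closure_iff.mpr fun O' hO' hzO' => ?_
    obtain ⟨b, hb, hbB⟩ := mem_closure_iff.mp hzB (O' ∩ O) (hO'.inter hO) ⟨hzO', hzO⟩
    refine ⟨b, hb.1, hbB, ?_⟩
    rw [hz]
    exact ⟨⟨b, subset_closure hbB⟩, hoZ hb.2, rfl⟩
  refine le_trans ?_ (h z key)
  have hsub : closure {z} ⊆ closure B := by
    rw [hz]; rintro _ ⟨a, _, rfl⟩; exact a.2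
  let g : ↥(closure {z}) → ↥(closure B) := Set.inclusion hsub
  have hg : IsInducing g := (IsEmbedding.inclusion hsub).isInducing
  have hr : ∀ i, (l i : Set ↥(closure B)) ⊆ Set.range g := fun i x hx => by
    have : x.1 ∈ closure {z} := by
      rw [hz]; exact ⟨x, hlZ ((l.monotone (Fin.le_last i) : l i ≤ l.last) hx), rfl⟩
    exact ⟨⟨x.1, this⟩, rfl⟩
  refine Order.LTSeries.length_le_krullDim (LTSeries.mk l.length
    (fun i => (⟨g ⁻¹' (l i), aux_irred_preimage g hg _ (l i).isIrreducible (hr i),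
      (l i).isClosed.preimage hg.continuous⟩ : IrreducibleCloseds ↥(closure {z}))) ?_)
  intro i j hij
  have hlt := l.strictMono hij
  refine lt_of_le_of_ne (fun x hx => hlt.le hx) fun he => hlt.ne ?_
  have he' : g ⁻¹' (l i) = g ⁻¹' (l j) := congrArg IrreducibleCloseds.carrier he
  apply IrreducibleCloseds.ext
  rw [← Set.image_preimage_eq_of_subset (hr i), he', Set.image_preimage_eq_of_subset (hr j)]
universe u

open TopologicalSpace Topology in
theorem aux_scheme_dim {X : Scheme.{u}} (K L : Type u) [Field K] [Field L]
    (g : X ⟶ Spec (.of K)) [LocallyOfFiniteType g]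
    (j : Spec (.of L) ⟶ X) [IsPreimmersion j] (φ : K →+* L)
    (hφ : Spec.map (CommRingCat.ofHom φ) = j ≫ g) (z : X) (hz : ∀ t, j t = z)
    (U : X.Opens) (hU : IsAffineOpen U) (hzU : z ∈ U) :
    ∃ n : ℕ, @Algebra.trdeg K L _ _ φ.toAlgebra = n ∧
      topologicalKrullDim ↥(closure {z} ∩ (U : Set X)) = n := by
  have hrange : Set.range j ⊆ Set.range hU.fromSpec := by
    rw [hU.range_fromSpec]; rintro _ ⟨t, rfl⟩; rw [hz]; exact hzU
  let j' : Spec (.of L) ⟶ Spec Γ(X, U) := IsOpenImmersion.lift hU.fromSpec j hrange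
  have hj' : j' ≫ hU.fromSpec = j := IsOpenImmersion.lift_fac _ _ _
  obtain ⟨e, he⟩ := Spec.map_surjective j'
  obtain ⟨α, hα⟩ := Spec.map_surjective (hU.fromSpec ≫ g)
  have hφe : CommRingCat.ofHom φ = α ≫ e := by
    apply Spec.map_injective
    rw [hφ, Spec.map_comp, hα, he, reassoc_of% hj']
  have hft : α.hom.FiniteType := by
    have : LocallyOfFiniteType (Spec.map α) := by rw [hα]; infer_instance
    exact HasRingHomProperty.Spec_iff.mp this
  have hss : e.hom.SurjectiveOnStalks := by
    have : IsPreimmersion (j' ≫ hU.fromSpec) := by rw [hj']; infer_instance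
    have : IsPreimmersion j' := IsPreimmersion.of_comp j' hU.fromSpec
    rw [← he] at this
    exact SurjectiveOnStalks.Spec_iff.mp inferInstance
  let _ : Algebra K Γ(X, U) := α.hom.toAlgebra
  let _ : Algebra Γ(X, U) L := e.hom.toAlgebra
  let _ : Algebra K L := φ.toAlgebra
  have : IsScalarTower K Γ(X, U) L := IsScalarTower.of_algebraMap_eq'
    (congrArg CommRingCat.Hom.hom hφe)
  have : Algebra.FiniteType K Γ(X, U) := hft
  obtain ⟨n, h1, h2⟩ := aux_dim_field K Γ(X, U) L (by
    intro x
    obtain ⟨a, r, c, hc, hr, hh⟩ := RingHom.surjectiveOnStalks_iff_forall_ideal.mp hss ⊥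
      bot_ne_top x
    refine ⟨a, r, fun h => hr h, ?_⟩
    have hc' : c ≠ 0 := fun h => hc h
    apply mul_left_cancel₀ hc'
    calc c * (x * e.hom r) = c * e.hom r * x := by ring
      _ = _ := hh)
  refine ⟨n, h1, ?_⟩
  rw [← h2, ← PrimeSpectrum.topologicalKrullDim_eq_ringKrullDim]
  let q : Ideal Γ(X, U) := RingHom.ker (algebraMap Γ(X, U) L)
  let F : PrimeSpectrum Γ(X, U) → X := fun p => hU.fromSpec p
  have hF : IsOpenEmbedding F := hU.fromSpec.isOpenEmbedding
  have hFr : Set.range F = (U : Set X) := hU.range_fromSpec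
  let h : PrimeSpectrum (Γ(X, U) ⧸ q) → X := F ∘ PrimeSpectrum.comap (Ideal.Quotient.mk q)
  have hemb : IsEmbedding h := hF.isEmbedding.comp
    (PrimeSpectrum.isClosedEmbedding_comap_of_surjective _ _
      Ideal.Quotient.mk_surjective).isEmbedding
  have hqp : q.IsPrime := RingHom.ker_isPrime _
  let Q : PrimeSpectrum Γ(X, U) := ⟨q, hqp⟩
  have hQz : F Q = z := by
    let pt : ↥(Spec (CommRingCat.of L)) := (⊥ : PrimeSpectrum L)
    have h1 : j' pt = Q := by
      rw [← he]; rfl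
    have h2 : hU.fromSpec (j' pt) = z := by
      rw [← Scheme.Hom.comp_apply, hj', hz]
    rw [h1] at h2
    exact h2
  have hr : Set.range h = closure {z} ∩ (U : Set X) := by
    have h0 : Set.range (PrimeSpectrum.comap (Ideal.Quotient.mk q)) = closure {Q} := by
      rw [range_comap_of_surjective _ _ Ideal.Quotient.mk_surjective,
        Ideal.mk_ker]
      exact (PrimeSpectrum.closure_singleton Q).symm
    have h3 : closure {Q} = F ⁻¹' (closure {z}) := by
      rw [hF.isInducing.closure_eq_preimage_closure_image, Set.image_singleton, hQz]
    have h4 : Set.range h = F '' Set.range (PrimeSpectrum.comap (Ideal.Quotient.mk q)) :=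
      Set.range_comp _ _
    rw [h4, h0, h3, Set.image_preimage_eq_inter_range, hFr]
  rw [← hr]
  exact (hemb.toHomeomorph.isHomeomorph.topologicalKrullDim_eq).symm

theorem aux_constructible_generic {X : Type*} [TopologicalSpace X] (A : Set X)
    (hA : IsConstructibleSet A) (B : Set X) (hB : B ⊆ A) (z : X)
    (hz : z ∈ closure (B ∩ closure {z})) :
    ∃ U Z : Set X, IsOpen U ∧ IsClosed Z ∧ z ∈ U ∧ z ∈ Z ∧ U ∩ Z ⊆ A := by
  obtain ⟨m, U, Z, hU, hZ, rfl⟩ := hA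
  have hsub : B ∩ closure {z} ⊆ ⋃ i, (U i ∩ Z i ∩ closure {z}) := by
    rintro b ⟨hb, hbz⟩
    obtain ⟨i, hi⟩ := Set.mem_iUnion.mp (hB hb)
    exact Set.mem_iUnion.mpr ⟨i, hi, hbz⟩
  have h1 := closure_mono hsub hz
  rw [closure_iUnion_of_finite] at h1
  obtain ⟨i, hi⟩ := Set.mem_iUnion.mp h1
  refine ⟨U i, Z i, hU i, hZ i, ?_, ?_, Set.subset_iUnion (fun i => U i ∩ Z i) i⟩
  · obtain ⟨b, hb, hbz⟩ := (closure_nonempty_iff.mp ⟨z, hi⟩)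
    exact (specializes_iff_mem_closure.mpr hbz).mem_open (hU i) hb.1
  · exact (hZ i).closure_subset_iff.mpr (fun x hx => hx.1.2) hi

theorem aux_dim_mono {X : Type*} [TopologicalSpace X] {S T : Set X} (h : S ⊆ T) :
    topologicalKrullDim S ≤ topologicalKrullDim T :=
  (Topology.IsEmbedding.inclusion h).isInducing.topologicalKrullDim_le

theorem stmt_19 (k : Type*) [Field k]
    (V W : Scheme) [IsIntegral V] [IsIntegral W]
    (sV : V ⟶ Spec (CommRingCat.of k)) (sW : W ⟶ Spec (CommRingCat.of k))
    [LocallyOfFiniteType sV] [LocallyOfFiniteType sW]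
    [QuasiCompact sV] [QuasiCompact sW]
    (f : V ⟶ W) (hf : f ≫ sW = sV)
    (d : ℕ) (A : Set V) (hA : IsConstructibleSet A)
    (hfib : ∀ y ∈ f.base '' A,
      topologicalKrullDim ↥(f.base ⁻¹' {y} ∩ A) ≤ (d : WithBot ℕ∞))
    (B : Set V) (hB : B ⊆ A) :
    topologicalKrullDim ↥(closure B) ≤
      (d : WithBot ℕ∞) + topologicalKrullDim ↥(closure (f.base '' B)) := by
  have : IsLocallyNoetherian V := LocallyOfFiniteType.isLocallyNoetherian sV
  have : CompactSpace V := (quasiCompact_iff_compactSpace sV).mp inferInstance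
  have : IsNoetherian V := {}
  have : LocallyOfFiniteType f := by
    have : LocallyOfFiniteType (f ≫ sW) := by rw [hf]; infer_instance
    exact locallyOfFiniteType_of_comp f sW
  refine aux_dim_closure B _ fun z hz => ?_
  obtain ⟨U, Z, hU, hZ, hzU, hzZ, hUZ⟩ := aux_constructible_generic A hA B hB z hz
  -- the three residue field extensions
  obtain ⟨φV, hφV⟩ := Spec.map_surjective (V.fromSpecResidueField z ≫ sV)
  obtain ⟨φW, hφW⟩ := Spec.map_surjective (W.fromSpecResidueField (f z) ≫ sW)
  have hcomp : φV = φW ≫ f.residueFieldMap z := by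
    apply Spec.map_injective
    rw [Spec.map_comp, hφV, hφW, Scheme.Hom.SpecMap_residueFieldMap_fromSpecResidueField_assoc, hf]
  -- local dimension of `closure {z}`
  have hV : ∀ (O : V.Opens), IsAffineOpen O → z ∈ O → _ := fun O hO hzO =>
    aux_scheme_dim k (V.residueField z) sV (V.fromSpecResidueField z) φV.hom hφV z
      (fun t => Scheme.fromSpecResidueField_apply z t) O hO hzO
  obtain ⟨OW, hOW, hyO, -⟩ := exists_isAffineOpen_mem_and_subset (X := W)
    (x := f z) (U := ⊤) trivial
  obtain ⟨nW, hW1, hW2⟩ := aux_scheme_dim k (W.residueField (f z)) sW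
    (W.fromSpecResidueField (f z)) φW.hom hφW (f z)
      (fun t => Scheme.fromSpecResidueField_apply (f z) t) OW hOW hyO
  let U' : V.Opens := ⟨U, hU⟩
  obtain ⟨OF, hOF, hzF, hOFU⟩ := exists_isAffineOpen_mem_and_subset (X := f.fiber (f z))
    (x := f.asFiber z) (U := f.fiberι (f z) ⁻¹ᵁ U') (by
      change f.fiberι _ (f.asFiber z) ∈ U'
      rw [Scheme.Hom.fiberι_asFiber]; exact hzU)
  have hlft : LocallyOfFiniteType (f.fiberToSpecResidueField (f z)) :=
    (inferInstance : LocallyOfFiniteType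
      (Limits.pullback.snd f (W.fromSpecResidueField (f z))))
  obtain ⟨nF, hF1, hF2⟩ := aux_scheme_dim (W.residueField (f z)) (V.residueField z)
    (f.fiberToSpecResidueField (f z)) (f.asFiberHom z) (f.residueFieldMap z).hom
    (f.asFiberHom_fiberToSpecResidueField z).symm (f.asFiber z)
    (fun t => f.asFiberHom_apply z t) OF hOF hzF
  -- fibre bound
  have hnF : ((nF : ℕ) : WithBot ℕ∞) ≤ d := by
    have hzA : z ∈ A := hUZ ⟨hzU, hzZ⟩
    refine le_trans ?_ (hfib (f z) ⟨z, hzA, rfl⟩)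
    rw [← hF2]
    have hmaps : ∀ x ∈ closure {f.asFiber z} ∩ (OF : Set (f.fiber (f z))),
        f.fiberι (f z) x ∈ f.base ⁻¹' {f z} ∩ A := by
      rintro x ⟨hx, hxO⟩
      refine ⟨?_, hUZ ⟨hOFU hxO, ?_⟩⟩
      · have : f.fiberι (f z) x ∈ Set.range (f.fiberι (f z)) := ⟨x, rfl⟩
        rw [Scheme.Hom.range_fiberι] at this
        exact this
      · have h1 : f.asFiber z ⤳ x := specializes_iff_mem_closure.mpr hx
        have h2 := h1.map (f.fiberι (f z)).continuous
        rw [Scheme.Hom.fiberι_asFiber] at h2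
        exact h2.mem_closed hZ hzZ
    have hind : Topology.IsInducing (fun x : ↥(closure {f.asFiber z} ∩ (OF : Set (f.fiber (f z)))) =>
        (⟨f.fiberι (f z) x.1, hmaps x.1 x.2⟩ : ↥(f.base ⁻¹' {f z} ∩ A))) := by
      rw [← Topology.IsInducing.subtypeVal.of_comp_iff]
      exact (f.fiberι (f z)).isEmbedding.isInducing.comp Topology.IsInducing.subtypeVal
    exact hind.topologicalKrullDim_le
  -- base bound
  have hnW : ((nW : ℕ) : WithBot ℕ∞) ≤ topologicalKrullDim ↥(closure (f.base '' B)) := by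
    rw [← hW2]
    apply aux_dim_mono
    refine Set.inter_subset_left.trans ?_
    refine isClosed_closure.closure_subset_iff.mpr (Set.singleton_subset_iff.mpr ?_)
    have hzB : z ∈ closure B := closure_mono Set.inter_subset_left hz
    exact image_closure_subset_closure_image f.continuous ⟨z, hzB, rfl⟩
  -- additivity of the transcendence degree
  have hadd : @Algebra.trdeg k (V.residueField z) _ _ φV.hom.toAlgebra =
      ((nF + nW : ℕ) : Cardinal) := by
    let _ : Algebra k (V.residueField z) := φV.hom.toAlgebra
    let _ : Algebra k (W.residueField (f z)) := φW.hom.toAlgebra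
    let _ : Algebra (W.residueField (f z)) (V.residueField z) :=
      (f.residueFieldMap z).hom.toAlgebra
    have : IsScalarTower k (W.residueField (f z)) (V.residueField z) :=
      IsScalarTower.of_algebraMap_eq' (congrArg CommRingCat.Hom.hom hcomp)
    have h := trdeg_add_eq k (W.residueField (f z)) (A := V.residueField z)
    refine h.symm.trans ?_
    refine (congrArg₂ (· + ·) hW1 hF1).trans ?_
    push_cast
    exact add_comm _ _
  refine le_trans (b := ((nF + nW : ℕ) : WithBot ℕ∞)) ?_ ?_
  · refine aux_dim_local _ fun x => ?_
    obtain ⟨O, hO, hxO, -⟩ := exists_isAffineOpen_mem_and_subset (X := V)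
      (x := x.1) (U := ⊤) trivial
    have hzO : z ∈ O := (specializes_iff_mem_closure.mpr x.2).mem_open O.2 hxO
    obtain ⟨n, hn1, hn2⟩ := hV O hO hzO
    have hn : n = nF + nW := by
      have := hn1.symm.trans hadd
      exact_mod_cast this
    refine ⟨Subtype.val ⁻¹' (O : Set V), O.2.preimage continuous_subtype_val, hxO, ?_⟩
    rw [← hn, ← hn2]
    have hind : Topology.IsInducing
        (fun t : ↥((Subtype.val : ↥(closure {z}) → V) ⁻¹' (O : Set V)) =>
          (⟨t.1.1, t.1.2, t.2⟩ : ↥(closure {z} ∩ (O : Set V)))) := by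
      have hval : Topology.IsInducing
          ((Subtype.val : ↥(closure {z}) → V) ∘
            (Subtype.val : ↥((Subtype.val : ↥(closure {z}) → V) ⁻¹' (O : Set V)) → _)) :=
        Topology.IsInducing.subtypeVal.comp Topology.IsInducing.subtypeVal
      rw [← Topology.IsInducing.subtypeVal.of_comp_iff]
      exact hval
    exact hind.topologicalKrullDim_le
  · push_cast
    exact add_le_add hnF hnW
end
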